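/- arXiv:1411.3833 — 2 statements merged into one kernel-verified Lean document; each statement's English description precedes it below -/
import Mathlib

section
/- Fix r ∈ (0,1]. Define [f]₁ = |f(x, x²)|_r and [f]₂ = |f(x, x² + x³)|_r for f ∈ K[x,y], where on univariate polynomials |Σᵢ aᵢ xⁱ|_r = maxᵢ |aᵢ| rⁱ. Then: (i) [·]₁ and [·]₂ are multiplicative seminorms on K[x,y] compatible with |·|; (ii) for every affine-linear polynomial f(x,y) = ax + by + c one has [f]₁ = max(|a|r, |b|r², |c|) and [f]₂ = max(|a|r, |b|r², |b|r³, |c|), and since r ≤ 1 these two values are equal; (iii) [x² − y]₁ = 0 while [x² − y]₂ = r³ > 0. In particular, there exist two distinct multiplicative seminorms on K[x,y] compatible with |·| that agree on all affine-linear polynomials, so the canonical map from (𝔸²)^an to the inverse limit of linear tropicalizations is not injective. -/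
open MvPolynomial

/-- A multiplicative seminorm on a commutative ring, with values in `ℝ` (nonnegative). -/
def IsMultSeminorm {A : Type*} [CommRing A] (p : A → ℝ) : Prop :=
  (∀ f, 0 ≤ p f) ∧ p 0 = 0 ∧ p 1 = 1 ∧ (∀ f g, p (f * g) = p f * p g) ∧
    (∀ f g, p (f + g) ≤ p f + p g)

/-- Compatibility of a multiplicative seminorm with the absolute value on the base field. -/
def IsCompatible {K A : Type*} [Field K] [CommRing A] [Algebra K A]
    (v : AbsoluteValue K ℝ) (p : A → ℝ) : Prop :=
  ∀ a : K, p (algebraMap K A a) = v a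

/-- `log : ℝ≥0 → ℝ ∪ {−∞}`, sending `0` to `−∞`. -/
noncomputable def elog (x : ℝ) : EReal := if x = 0 then ⊥ else (Real.log x : EReal)

/-- The valuation `ν = log |·| : K → ℝ ∪ {−∞}`, with `ν 0 = −∞`. -/
noncomputable def nu {K : Type*} [Field K] (v : AbsoluteValue K ℝ) (a : K) : EReal :=
  elog (v a)

/-- The Gauss norm `|Σ aᵢ xⁱ|_r = maxᵢ |aᵢ| rⁱ` on univariate polynomials. -/
noncomputable def gaussNorm {K : Type*} [Field K] (v : AbsoluteValue K ℝ) (r : ℝ)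
    (p : Polynomial K) : ℝ :=
  (Finset.range (p.natDegree + 1)).sup' (Finset.nonempty_range_iff.mpr (Nat.succ_ne_zero _))
    fun i => v (p.coeff i) * r ^ i

/-- The seminorm `f ↦ |f(x, x²)|_r` on `K[x,y]`. -/
noncomputable def sem1 {K : Type*} [Field K] (v : AbsoluteValue K ℝ) (r : ℝ)
    (f : MvPolynomial (Fin 2) K) : ℝ :=
  gaussNorm v r (MvPolynomial.aeval ![Polynomial.X, Polynomial.X ^ 2] f)

/-- The seminorm `f ↦ |f(x, x² + x³)|_r` on `K[x,y]`. -/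
noncomputable def sem2 {K : Type*} [Field K] (v : AbsoluteValue K ℝ) (r : ℝ)
    (f : MvPolynomial (Fin 2) K) : ℝ :=
  gaussNorm v r (MvPolynomial.aeval ![Polynomial.X, Polynomial.X ^ 2 + Polynomial.X ^ 3] f)

lemma gaussNorm_eq_polynomial_gaussNorm {K : Type*} [Field K] (v : AbsoluteValue K ℝ) {r : ℝ}
    (hr : 0 ≤ r) (p : Polynomial K) : gaussNorm v r p = p.gaussNorm v r := by
  apply le_antisymm
  · exact Finset.sup'_le _ _ fun i _ => p.le_gaussNorm v hr i
  · obtain ⟨i, hi⟩ := p.exists_eq_gaussNorm v r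
    rw [hi]
    by_cases h : i ≤ p.natDegree
    · exact Finset.le_sup' (fun i => v (p.coeff i) * r ^ i) (by simpa [Nat.lt_succ_iff] using h)
    · rw [Polynomial.coeff_eq_zero_of_natDegree_lt (not_le.mp h), map_zero, zero_mul]
      exact (mul_nonneg (v.nonneg _) (pow_nonneg hr 0)).trans
        (Finset.le_sup' (fun i => v (p.coeff i) * r ^ i) (by simp : 0 ∈ _))

lemma gaussNorm_eq_sup'_of_natDegree_le {K : Type*} [Field K] (v : AbsoluteValue K ℝ) {r : ℝ}
    (hr : 0 ≤ r) {p : Polynomial K} {n : ℕ} (hn : p.natDegree ≤ n) :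
    gaussNorm v r p = (Finset.range (n + 1)).sup'
      (Finset.nonempty_range_iff.mpr (Nat.succ_ne_zero _)) fun i => v (p.coeff i) * r ^ i := by
  apply le_antisymm
  · exact Finset.sup'_mono _ (Finset.range_mono (Nat.succ_le_succ hn)) _
  · rw [gaussNorm_eq_polynomial_gaussNorm v hr]
    exact Finset.sup'_le _ _ fun i _ => p.le_gaussNorm v hr i

lemma gaussNorm_of_natDegree_le_three {K : Type*} [Field K] (v : AbsoluteValue K ℝ) {r : ℝ}
    (hr : 0 ≤ r) {p : Polynomial K} (hp : p.natDegree ≤ 3) :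
    gaussNorm v r p = max (v (p.coeff 1) * r)
      (max (v (p.coeff 2) * r ^ 2) (max (v (p.coeff 3) * r ^ 3) (v (p.coeff 0)))) := by
  rw [gaussNorm_eq_sup'_of_natDegree_le v hr hp]
  apply le_antisymm
  · refine Finset.sup'_le _ _ fun i hi => ?_
    rw [Finset.mem_range] at hi
    interval_cases i <;> simp
  · have h (i : ℕ) (hi : i < 4) := Finset.le_sup' (fun i => v (p.coeff i) * r ^ i)
      (Finset.mem_range.mpr hi)
    have h1 := h 1 (by simp)
    have h0 := h 0 (by simp)
    rw [pow_one] at h1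
    rw [pow_zero, mul_one] at h0
    exact max_le h1 (max_le (h 2 (by simp)) (max_le (h 3 (by simp)) h0))

lemma isMultSeminorm_gaussNorm_comp {K A : Type*} [Field K] [CommRing A] [Algebra K A]
    {v : AbsoluteValue K ℝ} (hna : IsNonarchimedean v) {r : ℝ} (hr : 0 < r)
    (φ : A →ₐ[K] Polynomial K) : IsMultSeminorm fun f => gaussNorm v r (φ f) := by
  simp only [IsMultSeminorm, gaussNorm_eq_polynomial_gaussNorm v hr.le]
  refine ⟨fun f => Polynomial.gaussNorm_nonneg _ _ hr.le, by simp, ?_, fun f g => ?_,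
    fun f g => ?_⟩
  · rw [map_one, ← Polynomial.C_1, Polynomial.gaussNorm_C, map_one]
  · rw [map_mul, Polynomial.gaussNorm_mul hna hr]
  · rw [map_add]
    exact (Polynomial.isNonarchimedean_gaussNorm v hna hr.le _ _).trans
      (max_le_add_of_nonneg (Polynomial.gaussNorm_nonneg _ _ hr.le)
        (Polynomial.gaussNorm_nonneg _ _ hr.le))

lemma isCompatible_gaussNorm_comp {K A : Type*} [Field K] [CommRing A] [Algebra K A]
    (v : AbsoluteValue K ℝ) {r : ℝ} (hr : 0 ≤ r) (φ : A →ₐ[K] Polynomial K) :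
    IsCompatible v fun f => gaussNorm v r (φ f) := fun a => by
  simp [gaussNorm_eq_polynomial_gaussNorm v hr, Polynomial.algebraMap_eq]

lemma sem1_affine {K : Type*} [Field K] (v : AbsoluteValue K ℝ) {r : ℝ} (hr : 0 ≤ r)
    (a b c : K) : sem1 v r (C a * X 0 + C b * X 1 + C c) =
      max (v a * r) (max (v b * r ^ 2) (v c)) := by
  have h : aeval ![Polynomial.X, Polynomial.X ^ 2] (C a * X 0 + C b * X 1 + C c) =
      Polynomial.C a * Polynomial.X + Polynomial.C b * Polynomial.X ^ 2 + Polynomial.C c := by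
    simp [Polynomial.algebraMap_eq]
  rw [sem1, h, gaussNorm_of_natDegree_le_three v hr (by compute_degree!)]
  simp [Polynomial.coeff_X, Polynomial.coeff_C]

lemma sem2_affine {K : Type*} [Field K] (v : AbsoluteValue K ℝ) {r : ℝ} (hr : 0 ≤ r)
    (a b c : K) : sem2 v r (C a * X 0 + C b * X 1 + C c) =
      max (v a * r) (max (v b * r ^ 2) (max (v b * r ^ 3) (v c))) := by
  have h : aeval ![Polynomial.X, Polynomial.X ^ 2 + Polynomial.X ^ 3]
      (C a * X 0 + C b * X 1 + C c) =
      Polynomial.C a * Polynomial.X + Polynomial.C b * (Polynomial.X ^ 2 + Polynomial.X ^ 3) +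
        Polynomial.C c := by
    simp [Polynomial.algebraMap_eq]
  rw [sem2, h, gaussNorm_of_natDegree_le_three v hr (by compute_degree!)]
  simp [Polynomial.coeff_X, Polynomial.coeff_C, Polynomial.coeff_X_pow]

lemma sem1_affine_eq_sem2_affine {K : Type*} [Field K] (v : AbsoluteValue K ℝ) {r : ℝ}
    (hr : 0 ≤ r) (hr1 : r ≤ 1) (a b c : K) :
    sem1 v r (C a * X 0 + C b * X 1 + C c) = sem2 v r (C a * X 0 + C b * X 1 + C c) := by
  have h : v b * r ^ 3 ≤ v b * r ^ 2 :=
    mul_le_mul_of_nonneg_left (pow_le_pow_of_le_one hr hr1 (by norm_num)) (v.nonneg b)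
  rw [sem1_affine v hr, sem2_affine v hr, ← max_assoc (v b * r ^ 2), max_eq_left h]

lemma sem1_X_sq_sub_X {K : Type*} [Field K] (v : AbsoluteValue K ℝ) (r : ℝ) :
    sem1 v r (X 0 ^ 2 - X 1) = 0 := by
  simp [sem1, gaussNorm]

lemma sem2_X_sq_sub_X {K : Type*} [Field K] (v : AbsoluteValue K ℝ) {r : ℝ} (hr : 0 ≤ r) :
    sem2 v r (X 0 ^ 2 - X 1) = r ^ 3 := by
  have h : aeval ![Polynomial.X, Polynomial.X ^ 2 + Polynomial.X ^ 3]
      (X 0 ^ 2 - X 1 : MvPolynomial (Fin 2) K) = Polynomial.monomial 3 (-1 : K) := by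
    simp [← Polynomial.C_mul_X_pow_eq_monomial]
  rw [sem2, h, gaussNorm_eq_polynomial_gaussNorm v hr, Polynomial.gaussNorm_monomial]
  simp

lemma MvPolynomial.exists_eq_affine_of_totalDegree_le_one {R : Type*} [CommSemiring R]
    {f : MvPolynomial (Fin 2) R} (hf : f.totalDegree ≤ 1) :
    ∃ a b c : R, f = C a * X 0 + C b * X 1 + C c := by
  refine ⟨f.coeff (Finsupp.single 0 1), f.coeff (Finsupp.single 1 1), f.coeff 0, ?_⟩
  ext m
  have hm : m = 0 ∨ m = Finsupp.single 0 1 ∨ m = Finsupp.single 1 1 ∨ 1 < m 0 + m 1 := by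
    by_cases h : 1 < m 0 + m 1
    · simp [h]
    · have : (m 0 = 0 ∧ m 1 = 0) ∨ (m 0 = 1 ∧ m 1 = 0) ∨ (m 0 = 0 ∧ m 1 = 1) := by omega
      simpa [Finsupp.ext_iff, Fin.forall_fin_two, h] using this
  have h01 : Finsupp.single (0 : Fin 2) 1 ≠ Finsupp.single 1 1 := by
    simp [Finsupp.single_left_inj]
  simp only [coeff_add, coeff_C_mul, coeff_X, coeff_C]
  rcases hm with rfl | rfl | rfl | h
  · simp
  · simp [h01.symm, (Finsupp.single_ne_zero.mpr one_ne_zero).symm]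
  · simp [h01, (Finsupp.single_ne_zero.mpr one_ne_zero).symm]
  · rw [coeff_eq_zero_of_totalDegree_lt]
    · have h0 : Finsupp.single 0 1 ≠ m := by rintro rfl; simp at h
      have h1 : Finsupp.single 1 1 ≠ m := by rintro rfl; simp at h
      have h2 : 0 ≠ m := by rintro rfl; simp at h
      simp [h0, h1, h2]
    · have : ∑ i ∈ m.support, m i = m 0 + m 1 := by
        rw [← Fin.sum_univ_two, ← Finsupp.sum_fintype m (fun _ n => n) (fun _ => rfl)]; rfl
      omega

/-- Poineau's example: two distinct multiplicative seminorms on `K[x,y]` compatible with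
`|·|` which agree on all affine-linear polynomials; hence the canonical map from `(𝔸²)^an`
to the inverse limit of linear tropicalizations is not injective. -/
theorem statement_2 {K : Type*} [Field K] [IsAlgClosed K] [MetricSpace K] [CompleteSpace K]
    (v : AbsoluteValue K ℝ)
    (hna : ∀ a b : K, v (a + b) ≤ max (v a) (v b))
    (hnt : ∃ a : K, a ≠ 0 ∧ v a ≠ 1)
    (hdist : ∀ a b : K, dist a b = v (a - b))
    (r : ℝ) (hr0 : 0 < r) (hr1 : r ≤ 1) :
    (IsMultSeminorm (sem1 v r) ∧ IsCompatible v (sem1 v r) ∧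
      IsMultSeminorm (sem2 v r) ∧ IsCompatible v (sem2 v r)) ∧
    (∀ a b c : K,
      sem1 v r (C a * X 0 + C b * X 1 + C c) = max (v a * r) (max (v b * r ^ 2) (v c)) ∧
      sem2 v r (C a * X 0 + C b * X 1 + C c) =
        max (v a * r) (max (v b * r ^ 2) (max (v b * r ^ 3) (v c))) ∧
      sem1 v r (C a * X 0 + C b * X 1 + C c) = sem2 v r (C a * X 0 + C b * X 1 + C c)) ∧
    (sem1 v r (X 0 ^ 2 - X 1) = 0 ∧ sem2 v r (X 0 ^ 2 - X 1) = r ^ 3 ∧ 0 < r ^ 3) ∧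
    (∃ q₁ q₂ : MvPolynomial (Fin 2) K → ℝ,
      IsMultSeminorm q₁ ∧ IsCompatible v q₁ ∧ IsMultSeminorm q₂ ∧ IsCompatible v q₂ ∧
      q₁ ≠ q₂ ∧ ∀ f : MvPolynomial (Fin 2) K, f.totalDegree ≤ 1 → q₁ f = q₂ f) := by
  have hs1 : IsMultSeminorm (sem1 v r) := isMultSeminorm_gaussNorm_comp hna hr0 _
  have hs2 : IsMultSeminorm (sem2 v r) := isMultSeminorm_gaussNorm_comp hna hr0 _
  have hc1 : IsCompatible v (sem1 v r) := isCompatible_gaussNorm_comp v hr0.le _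
  have hc2 : IsCompatible v (sem2 v r) := isCompatible_gaussNorm_comp v hr0.le _
  refine ⟨⟨hs1, hc1, hs2, hc2⟩, fun a b c => ⟨sem1_affine v hr0.le a b c,
    sem2_affine v hr0.le a b c, sem1_affine_eq_sem2_affine v hr0.le hr1 a b c⟩,
    ⟨sem1_X_sq_sub_X v r, sem2_X_sq_sub_X v hr0.le, pow_pos hr0 3⟩,
    sem1 v r, sem2 v r, hs1, hc1, hs2, hc2, fun h => ?_, fun f hf => ?_⟩
  · have h' := congr_fun h (X 0 ^ 2 - X 1)
    rw [sem1_X_sq_sub_X, sem2_X_sq_sub_X v hr0.le] at h'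
    exact (pow_pos hr0 3).ne h'
  · obtain ⟨a, b, c, rfl⟩ := exists_eq_affine_of_totalDegree_le_one hf
    exact sem1_affine_eq_sem2_affine v hr0.le hr1 a b c
end

section
/- Let [·]₁ and [·]₂ be multiplicative seminorms on the univariate polynomial ring K[x] compatible with |·|. If [p]₁ = [p]₂ for every polynomial p ∈ K[x] of degree at most 1, then [·]₁ = [·]₂. (Since K is algebraically closed, every polynomial factors into linear factors, so a multiplicative seminorm on K[x] compatible with |·| is determined by its values on linear polynomials; this says that the canonical map from (𝔸¹)^an to the inverse limit of linear tropicalizations of 𝔸¹ is injective.) -/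
open MvPolynomial

/-- Two multiplicative functions on `K[x]`, for `K` algebraically closed, agree as soon as they
agree on polynomials of degree at most one. -/
theorem eq_of_map_mul_of_eq_natDegree_le_one {K M : Type*} [Field K] [IsAlgClosed K] [Mul M]
    {p₁ p₂ : Polynomial K → M} (h₁ : ∀ f g, p₁ (f * g) = p₁ f * p₁ g)
    (h₂ : ∀ f g, p₂ (f * g) = p₂ f * p₂ g)
    (h : ∀ q : Polynomial K, q.natDegree ≤ 1 → p₁ q = p₂ q) : p₁ = p₂ := by
  funext f
  induction IsAlgClosed.splits f using Submonoid.closure_induction with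
  | mem q hq =>
    rcases hq with ⟨a, rfl⟩ | ⟨a, rfl⟩
    · exact h _ (by simp)
    · exact h _ (Polynomial.natDegree_X_add_C a).le
  | one => exact h _ (by simp)
  | mul f g _ _ hf hg => rw [h₁, h₂, hf, hg]

/-- A multiplicative seminorm on `K[x]` compatible with `|·|` is determined by its values
on polynomials of degree at most one. -/
theorem statement_3 {K : Type*} [Field K] [IsAlgClosed K] [MetricSpace K] [CompleteSpace K]
    (v : AbsoluteValue K ℝ)
    (hna : ∀ a b : K, v (a + b) ≤ max (v a) (v b))
    (hnt : ∃ a : K, a ≠ 0 ∧ v a ≠ 1)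
    (hdist : ∀ a b : K, dist a b = v (a - b))
    (p₁ p₂ : Polynomial K → ℝ)
    (h₁ : IsMultSeminorm p₁) (hc₁ : IsCompatible v p₁)
    (h₂ : IsMultSeminorm p₂) (hc₂ : IsCompatible v p₂)
    (h : ∀ q : Polynomial K, q.natDegree ≤ 1 → p₁ q = p₂ q) :
    p₁ = p₂ := by
  obtain ⟨-, -, -, hmul₁, -⟩ := h₁
  obtain ⟨-, -, -, hmul₂, -⟩ := h₂
  exact eq_of_map_mul_of_eq_natDegree_le_one hmul₁ hmul₂ h
end
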